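/- Every connected cubic graph on n = 4t vertices contains a spanning subgraph with exactly t+1 vertices of degree 0, t+1 vertices of degree 1, t−1 vertices of degree 2, and t−1 vertices of degree 3. -/

import Mathlib

open SimpleGraph

/-- The degree of `v` in `H`, as the cardinality of its neighbor set. -/
noncomputable def nDeg {V : Type*} (H : SimpleGraph V) (v : V) : ℕ :=
  (H.neighborSet v).ncard

/-- The number of vertices of degree `k` in `H`. -/
noncomputable def degCount {V : Type*} (H : SimpleGraph V) (k : ℕ) : ℕ :=
  {v | nDeg H v = k}.ncard

def K4 : SimpleGraph (Fin 4) := completeGraph (Fin 4)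

def K33 : SimpleGraph (Fin 3 ⊕ Fin 3) := completeBipartiteGraph (Fin 3) (Fin 3)

/-- The disjoint union of `m` copies of `K₄`. -/
def unionK4 (m : ℕ) : SimpleGraph (Fin m × Fin 4) :=
  SimpleGraph.fromRel (fun p q => p.1 = q.1)

section Auxiliary

variable {V : Type*} [Fintype V]

open Classical in
lemma nDeg_eq_card (H : SimpleGraph V) (v : V) :
    nDeg H v = (Finset.univ.filter (H.Adj v)).card := by
  rw [nDeg, ← Set.ncard_coe_finset]
  congr 1
  ext w
  simp

open Classical in
lemma degCount_eq_card (H : SimpleGraph V) (k : ℕ) :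
    degCount H k = (Finset.univ.filter fun v => nDeg H v = k).card := by
  rw [degCount, ← Set.ncard_coe_finset]
  congr 1
  ext w
  simp

open Classical in
lemma exists_insert_edge {G H : SimpleGraph V} (hle : H ≤ G) {a b : V} (hG : G.Adj a b)
    (hH : ¬ H.Adj a b) :
    ∃ H' ≤ G, (∀ x y, H'.Adj x y ↔ H.Adj x y ∨ (x = a ∧ y = b) ∨ (x = b ∧ y = a)) ∧
      (∀ v, nDeg H' v = nDeg H v + if v = a ∨ v = b then 1 else 0) ∧
      ∀ k, degCount H' k + ((if nDeg H a = k then 1 else 0) + if nDeg H b = k then 1 else 0) =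
        degCount H k + ((if nDeg H a + 1 = k then 1 else 0) +
          if nDeg H b + 1 = k then 1 else 0) := by
  have hab : a ≠ b := hG.ne
  have hAdj : ∀ x y, (H ⊔ edge a b).Adj x y ↔
      H.Adj x y ∨ (x = a ∧ y = b) ∨ (x = b ∧ y = a) := by
    intro x y
    rw [sup_adj, edge_adj]
    grind
  have hdeg : ∀ v, nDeg (H ⊔ edge a b) v = nDeg H v + if v = a ∨ v = b then 1 else 0 := by
    intro v
    rw [nDeg_eq_card, nDeg_eq_card]
    have hba : ¬ H.Adj b a := fun h => hH h.symm
    by_cases hva : v = a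
    · subst hva
      rw [if_pos (Or.inl rfl), ← Finset.card_insert_of_notMem (a := b) (by simpa using hH)]
      congr 1
      ext w
      simp [hAdj, hab, or_comm]
    · by_cases hvb : v = b
      · subst hvb
        rw [if_pos (Or.inr rfl), ← Finset.card_insert_of_notMem (a := a) (by simpa using hba)]
        congr 1
        ext w
        simp [hAdj, hva, or_comm]
      · simp [hAdj, hva, hvb]
  refine ⟨H ⊔ edge a b, sup_le hle ((edge_le_iff G).2 (Or.inr hG)), hAdj, hdeg, fun k => ?_⟩
  have key : ∀ f : V → ℕ, (Finset.univ.filter fun v => f v = k).card =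
      ((if f a = k then 1 else 0) + if f b = k then 1 else 0) +
        ∑ v ∈ (Finset.univ.erase a).erase b, if f v = k then 1 else 0 := by
    intro f
    rw [Finset.card_filter, ← Finset.add_sum_erase _ _ (Finset.mem_univ a),
      ← Finset.add_sum_erase (Finset.univ.erase a) _ (by simp [hab.symm] : b ∈ _), add_assoc]
  rw [degCount_eq_card, degCount_eq_card, key, key]
  have hrest : ∑ v ∈ (Finset.univ.erase a).erase b, (if nDeg (H ⊔ edge a b) v = k then 1 else 0) =
      ∑ v ∈ (Finset.univ.erase a).erase b, if nDeg H v = k then 1 else 0 := by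
    refine Finset.sum_congr rfl fun v hv => ?_
    simp only [Finset.mem_erase, Finset.mem_univ, and_true] at hv
    simp [hdeg, hv.1, hv.2]
  rw [hrest, hdeg a, hdeg b, if_pos (Or.inl rfl), if_pos (Or.inr rfl)]
  omega

/-- Double counting of the edges of `D` leaving `X`. -/
lemma sum_nDeg_le {D : SimpleGraph V} (X : Finset V) (g : V → ℕ)
    (hg : ∀ s, nDeg D s ≤ g s ∨ ∀ x ∈ X, ¬ D.Adj x s) :
    ∑ x ∈ X, nDeg D x ≤ ∑ s, g s := by
  classical
  simp only [nDeg_eq_card, Finset.card_filter]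
  rw [Finset.sum_comm]
  refine Finset.sum_le_sum fun s _ => ?_
  rcases hg s with h | h
  · refine le_trans ?_ h
    rw [nDeg_eq_card, Finset.card_filter]
    simp only [D.adj_comm s]
    exact Finset.sum_le_sum_of_subset (Finset.subset_univ X)
  · rw [Finset.sum_eq_zero]
    · exact Nat.zero_le _
    · intro x hx
      simp [h x hx]

lemma exists_adj_ne_of_lt_nDeg {D : SimpleGraph V} {v a : V} (h : 1 < nDeg D v) :
    ∃ w, D.Adj v w ∧ w ≠ a := by
  classical
  rw [nDeg_eq_card] at h
  obtain ⟨w, hw, hne⟩ := Finset.exists_mem_ne h a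
  exact ⟨w, by simpa using hw, hne⟩

lemma exists_adj_ne_ne_of_lt_nDeg {D : SimpleGraph V} {v a b : V} (h : 2 < nDeg D v) :
    ∃ w, D.Adj v w ∧ w ≠ a ∧ w ≠ b := by
  classical
  rw [nDeg_eq_card] at h
  obtain ⟨w, hw, hne⟩ := Finset.exists_mem_notMem_of_card_lt_card
    (s := {a, b}) (lt_of_le_of_lt Finset.card_le_two h)
  simp at hw hne
  tauto

lemma nDeg_sdiff_add {G H : SimpleGraph V} (hle : H ≤ G) (v : V) :
    nDeg (G \ H) v + nDeg H v = nDeg G v := by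
  rw [nDeg, nDeg, nDeg, ← Set.ncard_union_eq]
  · congr 1
    ext w
    have := @hle v w
    simp
    tauto
  · rw [Set.disjoint_left]
    simp

lemma nDeg_pos_of_adj {D : SimpleGraph V} {v w : V} (h : D.Adj v w) : 0 < nDeg D v := by
  classical
  rw [nDeg_eq_card]
  exact Finset.card_pos.2 ⟨w, by simpa using h⟩

lemma lt_nDeg_of_adj_adj {D : SimpleGraph V} {v a b c : V} (ha : D.Adj v a) (hb : D.Adj v b)
    (hc : D.Adj v c) (hab : a ≠ b) (hac : a ≠ c) (hbc : b ≠ c) : 2 < nDeg D v := by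
  classical
  rw [nDeg_eq_card]
  exact Finset.two_lt_card.2 ⟨a, by simpa, b, by simpa, c, by simpa, hab, hac, hbc⟩

lemma SimpleGraph.Connected.exists_adj_mem_notMem {V : Type*} {G : SimpleGraph V}
    (hG : G.Connected) {X : Set V}
    {x y : V} (hx : x ∈ X) (hy : y ∉ X) : ∃ v ∈ X, ∃ w ∉ X, G.Adj v w := by
  obtain ⟨p⟩ := hG.preconnected x y
  obtain ⟨d, -, h1, h2⟩ := p.exists_boundary_dart X hx hy
  exact ⟨d.fst, h1, d.snd, h2, d.adj⟩

/-- A spanning subgraph of `G` whose nontrivial part has the degree statistics of a tree with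
`b + 2` leaves, `b` vertices of degree 2 and `b` vertices of degree 3. -/
structure HasTreeProfile (G H : SimpleGraph V) (b : ℕ) : Prop where
  le : H ≤ G
  zero : degCount H 0 + 3 * b + 2 = Fintype.card V
  one : degCount H 1 = b + 2
  two : degCount H 2 = b
  three : degCount H 3 = b

open Classical in
lemma HasTreeProfile.succ_of_insert_three {G H : SimpleGraph V} {b : ℕ}
    (hB : HasTreeProfile G H b) {a₁ b₁ a₂ b₂ a₃ b₃ : V} (p₁ q₁ p₂ q₂ p₃ q₃ : ℕ)
    (e₁ : (G \ H).Adj a₁ b₁) (e₂ : (G \ H).Adj a₂ b₂) (e₃ : (G \ H).Adj a₃ b₃)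
    (h₁₂ : ¬ (a₂ = a₁ ∧ b₂ = b₁) ∧ ¬ (a₂ = b₁ ∧ b₂ = a₁))
    (h₁₃ : ¬ (a₃ = a₁ ∧ b₃ = b₁) ∧ ¬ (a₃ = b₁ ∧ b₃ = a₁))
    (h₂₃ : ¬ (a₃ = a₂ ∧ b₃ = b₂) ∧ ¬ (a₃ = b₂ ∧ b₃ = a₂))
    (hp₁ : nDeg H a₁ = p₁) (hq₁ : nDeg H b₁ = q₁)
    (hp₂ : nDeg H a₂ + (if a₂ = a₁ ∨ a₂ = b₁ then 1 else 0) = p₂)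
    (hq₂ : nDeg H b₂ + (if b₂ = a₁ ∨ b₂ = b₁ then 1 else 0) = q₂)
    (hp₃ : nDeg H a₃ + (if a₃ = a₁ ∨ a₃ = b₁ then 1 else 0) +
      (if a₃ = a₂ ∨ a₃ = b₂ then 1 else 0) = p₃)
    (hq₃ : nDeg H b₃ + (if b₃ = a₁ ∨ b₃ = b₁ then 1 else 0) +
      (if b₃ = a₂ ∨ b₃ = b₂ then 1 else 0) = q₃)
    (hk : ∀ k < 4, ([p₁ + 1, q₁ + 1, p₂ + 1, q₂ + 1, p₃ + 1, q₃ + 1].count k) +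
        (if k = 0 then 3 else 0) =
      ([p₁, q₁, p₂, q₂, p₃, q₃].count k) + (if k = 0 then 0 else 1)) :
    ∃ H', HasTreeProfile G H' (b + 1) := by
  rw [sdiff_adj] at e₁ e₂ e₃
  obtain ⟨H₁, le₁, adj₁, deg₁, cnt₁⟩ := exists_insert_edge hB.le e₁.1 e₁.2
  obtain ⟨H₂, le₂, adj₂, deg₂, cnt₂⟩ := exists_insert_edge le₁ e₂.1
    (by rw [adj₁]; have := e₂.2; tauto)
  obtain ⟨H₃, le₃, adj₃, deg₃, cnt₃⟩ := exists_insert_edge le₂ e₃.1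
    (by rw [adj₂, adj₁]; have := e₃.2; tauto)
  rw [← deg₁] at hp₂ hq₂
  rw [← deg₁, ← deg₂] at hp₃ hq₃
  rw [hp₁, hq₁] at cnt₁
  rw [hp₂, hq₂] at cnt₂
  rw [hp₃, hq₃] at cnt₃
  have key : ∀ k < 4, degCount H₃ k + (if k = 0 then 3 else 0) =
      degCount H k + (if k = 0 then 0 else 1) := by
    intro k hk4
    have h := hk k hk4
    have c₁ := cnt₁ k
    have c₂ := cnt₂ k
    have c₃ := cnt₃ k
    simp only [List.count_cons, List.count_nil, beq_iff_eq] at h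
    omega
  have k0 := key 0 (by norm_num)
  have k1 := key 1 (by norm_num)
  have k2 := key 2 (by norm_num)
  have k3 := key 3 (by norm_num)
  simp at k0 k1 k2 k3
  obtain ⟨-, h0, h1, h2, h3⟩ := hB
  exact ⟨H₃, le₃, by omega, by omega, by omega, by omega⟩

open Classical in
lemma exists_hasTreeProfile_zero [Nonempty V] {G : SimpleGraph V} (hG : ∀ v, 0 < nDeg G v) :
    ∃ H, HasTreeProfile G H 0 := by
  obtain ⟨v⟩ := ‹Nonempty V›
  have h := hG v
  rw [nDeg_eq_card, Finset.card_pos] at h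
  obtain ⟨w, hw⟩ := h
  have hd : ∀ v, nDeg (⊥ : SimpleGraph V) v = 0 := by simp [nDeg_eq_card]
  obtain ⟨H, hle, -, -, hc⟩ := exists_insert_edge (bot_le : ⊥ ≤ G)
    (by simpa using hw : G.Adj v w) (by simp)
  simp only [hd] at hc
  have c : ∀ k, degCount (⊥ : SimpleGraph V) k = if k = 0 then Fintype.card V else 0 := by
    intro k
    simp only [degCount_eq_card, hd]
    split_ifs with hk
    · simp [hk]
    · simp [Ne.symm hk]
  refine ⟨H, hle, ?_, ?_, ?_, ?_⟩
  · simpa [c] using hc 0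
  · simpa [c] using hc 1
  · simpa [c] using hc 2
  · simpa [c] using hc 3

section Extension

variable {G H : SimpleGraph V} {b : ℕ}

lemma HasTreeProfile.nDeg_sdiff (hB : HasTreeProfile G H b) (hG : ∀ v, nDeg G v = 3) (v : V) :
    nDeg (G \ H) v + nDeg H v = 3 :=
  (nDeg_sdiff_add hB.le v).trans (hG v)

lemma sdiff_adj_of_nDeg_eq_zero {v w : V} (h : G.Adj v w) (hv : nDeg H v = 0) :
    (G \ H).Adj v w :=
  ⟨h, fun h' => (nDeg_pos_of_adj h').ne' hv⟩

lemma HasTreeProfile.exists_isolated_edge (hB : HasTreeProfile G H b) (hG : ∀ v, nDeg G v = 3)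
    (hb : b + 6 ≤ degCount H 0) (v : V) :
    ∃ w w', (G \ H).Adj w w' ∧ nDeg H w = 0 ∧ nDeg H w' = 0 ∧ w ≠ v ∧ w' ≠ v := by
  classical
  by_contra! hcon
  have hsum := sum_nDeg_le (D := G \ H)
    ((Finset.univ.filter fun x => nDeg H x = 0).erase v)
    (fun s => (if nDeg H s = 1 then 2 else 0) + (if nDeg H s = 2 then 1 else 0) +
      (if s = v then 3 else 0)) (fun s => by
        have := hB.nDeg_sdiff hG s
        by_cases hs : s = v
        · left; simp [hs]; grind
        by_cases h0 : nDeg H s = 0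
        · right
          intro x hx hadj
          simp only [Finset.mem_erase, Finset.mem_filter, Finset.mem_univ, true_and] at hx
          exact hs (hcon x s hadj hx.2 h0 hx.1)
        · left; grind)
  have hX : ∀ x ∈ (Finset.univ.filter fun x => nDeg H x = 0).erase v, nDeg (G \ H) x = 3 := by
    intro x hx
    have := hB.nDeg_sdiff hG x
    simp at hx
    omega
  have hcard := Finset.pred_card_le_card_erase (s := Finset.univ.filter fun x => nDeg H x = 0)
    (a := v)
  rw [← degCount_eq_card] at hcard
  rw [Finset.sum_congr rfl hX] at hsum
  have e1 : ∀ k c : ℕ, (∑ s, if nDeg H s = k then c else 0) = degCount H k * c := by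
    intro k c
    rw [← Finset.sum_filter, Finset.sum_const, degCount_eq_card, smul_eq_mul]
  simp only [Finset.sum_add_distrib, Finset.sum_const, smul_eq_mul, e1, hB.one, hB.two,
    Finset.sum_ite_eq', Finset.mem_univ, if_true] at hsum
  omega

/-- If no two leaves of `H` are joined outside `H` but some vertex of degree 2 sees an isolated
vertex, then leaf-isolated edges survive the deletion of any leaf and any isolated vertex. -/
lemma HasTreeProfile.exists_leaf_isolated (hB : HasTreeProfile G H b) (hG : ∀ v, nDeg G v = 3)
    (hLL : ∀ x y, (G \ H).Adj x y → nDeg H x = 1 → nDeg H y ≠ 1) {u v : V}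
    (huv : (G \ H).Adj u v) (hu : nDeg H u = 2) (hv : nDeg H v = 0) (l r : V) :
    ∃ x y, (G \ H).Adj x y ∧ nDeg H x = 1 ∧ nDeg H y = 0 ∧ x ≠ l ∧ y ≠ r := by
  classical
  by_contra! hcon
  have hsum := sum_nDeg_le (D := G \ H)
    ((Finset.univ.filter fun x => nDeg H x = 1).erase l)
    (fun s => (if s ∈ (Finset.univ.filter fun x => nDeg H x = 2).erase u then 1 else 0) +
      (if s = r then 3 else 0)) (fun s => by
        have hs3 := hB.nDeg_sdiff hG s
        by_cases hs : s = r
        · left; simp [hs]; grind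
        by_cases h0 : nDeg H s = 0 ∨ nDeg H s = 1 ∨ s = u
        · right
          intro x hx hadj
          simp only [Finset.mem_erase, Finset.mem_filter, Finset.mem_univ, true_and] at hx
          rcases h0 with h0 | h0 | h0
          · exact hs (hcon x s hadj hx.2 h0 hx.1)
          · exact hLL x s hadj hx.2 h0
          · subst h0
            have h1 : nDeg (G \ H) s = 1 := by omega
            have hxv : x ≠ v := by rintro rfl; omega
            have : 1 < nDeg (G \ H) s := by
              rw [nDeg_eq_card]
              exact Finset.one_lt_card.2 ⟨x, by simpa using hadj.symm, v, by simpa using huv, hxv⟩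
            omega
        · left; simp; grind)
  have hX : ∀ x ∈ (Finset.univ.filter fun x => nDeg H x = 1).erase l, nDeg (G \ H) x = 2 := by
    intro x hx
    have := hB.nDeg_sdiff hG x
    simp at hx
    omega
  have hcard := Finset.pred_card_le_card_erase (s := Finset.univ.filter fun x => nDeg H x = 1)
    (a := l)
  have hcard' := Finset.card_erase_add_one (s := Finset.univ.filter fun x => nDeg H x = 2)
    (a := u) (by simpa using hu)
  rw [← degCount_eq_card, hB.one] at hcard
  rw [← degCount_eq_card, hB.two] at hcard'
  rw [Finset.sum_congr rfl hX] at hsum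
  simp only [Finset.sum_add_distrib, Finset.sum_const, smul_eq_mul, Finset.sum_ite_mem,
    Finset.univ_inter, mul_one, Finset.sum_ite_eq', Finset.mem_univ, if_true] at hsum
  omega

lemma HasTreeProfile.exists_succ (hB : HasTreeProfile G H b) (hG : ∀ v, nDeg G v = 3)
    (hconn : G.Connected) (hb : b + 6 ≤ degCount H 0) : ∃ H', HasTreeProfile G H' (b + 1) := by
  have hd := hB.nDeg_sdiff hG
  have hiso := hB.exists_isolated_edge hG hb
  have hpos : ∀ {x y}, (G \ H).Adj x y → 0 < nDeg (G \ H) x := nDeg_pos_of_adj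
  by_cases hMR : ∃ u v, (G \ H).Adj u v ∧ nDeg H u = 2 ∧ nDeg H v = 0
  · obtain ⟨u, v, huv, hu, hv⟩ := hMR
    obtain ⟨w, w', hww, hw, hw', hwv, hwv'⟩ := hiso v
    by_cases hLL : ∃ x y, (G \ H).Adj x y ∧ nDeg H x = 1 ∧ nDeg H y = 1
    · obtain ⟨x, y, hxy, hx, hy⟩ := hLL
      exact hB.succ_of_insert_three 2 0 1 1 0 0 huv hxy hww (by grind) (by grind) (by grind)
        hu hv (by grind) (by grind) (by grind) (by grind) (by decide)
    by_cases hvL : ∃ l, (G \ H).Adj v l ∧ nDeg H l = 1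
    · obtain ⟨l, hvl, hl⟩ := hvL
      exact hB.succ_of_insert_three 2 0 1 1 0 0 huv hvl hww (by grind) (by grind) (by grind)
        hu hv (by grind) (by grind) (by grind) (by grind) (by decide)
    push Not at hLL hvL
    have hex := hB.exists_leaf_isolated hG hLL huv hu hv
    obtain ⟨l₁, r₁, h₁, hl₁, hr₁, -, -⟩ := hex v v
    obtain ⟨l₂, r₂, h₂, hl₂, hr₂, hl, hr⟩ := hex l₁ r₁
    have hv₁ : r₁ ≠ v := by
      rintro rfl
      exact hvL _ h₁.symm hl₁
    have hv₂ : r₂ ≠ v := by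
      rintro rfl
      exact hvL _ h₂.symm hl₂
    exact hB.succ_of_insert_three 2 0 1 0 1 0 huv h₁ h₂ (by grind) (by grind) (by grind)
      hu hv (by grind) (by grind) (by grind) (by grind) (by decide)
  push Not at hMR
  have hleaf : ∀ {x y}, (G \ H).Adj x y → nDeg H x = 0 → nDeg H y ≠ 0 → nDeg H y = 1 := by
    intro x y h hx hy
    have h1 := hd y
    have h2 := hpos h.symm
    have h3 := hMR y x h.symm
    omega
  obtain ⟨z, hz⟩ : ∃ z, nDeg H z = 1 := by
    classical
    have h1 := hB.one
    rw [degCount_eq_card] at h1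
    obtain ⟨z, hz⟩ := Finset.card_pos.1
      (by omega : 0 < (Finset.univ.filter fun v => nDeg H v = 1).card)
    exact ⟨z, by simpa using hz⟩
  obtain ⟨r₀, -, -, hr₀, -⟩ := hiso z
  obtain ⟨r, hr, y, hy, hry⟩ := hconn.exists_adj_mem_notMem
    (X := {v | nDeg H v = 0}) (x := r₀) (y := z) hr₀ (by simp [hz])
  have hry := sdiff_adj_of_nDeg_eq_zero hry hr
  have hy := hleaf hry hr hy
  have hr : nDeg H r = 0 := hr
  by_cases hLM : ∃ x m, (G \ H).Adj x m ∧ nDeg H x = 1 ∧ nDeg H m = 2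
  · obtain ⟨x, m, hxm, hx, hm⟩ := hLM
    by_cases hlr : ∃ l r, (G \ H).Adj l r ∧ nDeg H l = 1 ∧ nDeg H r = 0 ∧ l ≠ x
    · obtain ⟨l, r, h, hl, hr, hlx⟩ := hlr
      obtain ⟨w, w', hww, hw, hw', hwr, hwr'⟩ := hiso r
      exact hB.succ_of_insert_three 1 2 1 0 0 0 hxm h hww (by grind) (by grind) (by grind)
        hx hm (by grind) (by grind) (by grind) (by grind) (by decide)
    push Not at hlr
    have hnb : ∀ {w}, (G \ H).Adj r w → w ≠ x → nDeg H w = 0 := by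
      intro w hw hwx
      by_contra hw0
      exact hwx (hlr w r hw.symm (hleaf hw hr hw0) hr)
    obtain ⟨w, hw, hwx⟩ := exists_adj_ne_of_lt_nDeg (D := G \ H) (v := r) (a := x)
      (by have := hd r; omega)
    obtain ⟨w', hw', hwx', hww'⟩ := exists_adj_ne_ne_of_lt_nDeg (D := G \ H) (v := r) (a := x)
      (b := w) (by have := hd r; omega)
    have h0 := hnb hw hwx
    have h0' := hnb hw' hwx'
    have := hw.ne
    have := hw'.ne
    exact hB.succ_of_insert_three 1 2 0 0 1 0 hxm hw hw' (by grind) (by grind) (by grind)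
      hx hm (by grind) (by grind) (by grind) (by grind) (by decide)
  push Not at hLM
  obtain ⟨v, hyv, hvr⟩ := exists_adj_ne_of_lt_nDeg (D := G \ H) (v := y) (a := r)
    (by have := hd y; omega)
  by_cases hv : nDeg H v = 0
  · obtain ⟨s, hs⟩ : ∃ s, nDeg H s = 0 ∧ s ≠ r ∧ s ≠ v := by
      obtain ⟨s, s', hss, hs, hs', hsr, hsr'⟩ := hiso r
      by_cases h : s = v
      · exact ⟨s', hs', hsr', h ▸ hss.ne'⟩
      · exact ⟨s, hs, hsr, h⟩
    obtain ⟨w, ⟨hw, hwr, hwv⟩, q, hq, hwq⟩ := hconn.exists_adj_mem_notMem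
      (X := {w | nDeg H w = 0 ∧ w ≠ r ∧ w ≠ v}) (x := s) (y := z) hs (by simp [hz])
    have hwq := sdiff_adj_of_nDeg_eq_zero hwq hw
    have hqy : q ≠ y := by
      rintro rfl
      have h1 := lt_nDeg_of_adj_adj hwq.symm hry.symm hyv hwr hwv hvr.symm
      have h2 := hd q
      omega
    have hq1 : nDeg H q = 1 ∨ q = r ∨ q = v := by
      by_cases hq0 : nDeg H q = 0
      · by_contra! h
        exact hq ⟨hq0, h.2⟩
      · exact Or.inl (hleaf hwq hw hq0)
    exact hB.succ_of_insert_three 1 0 2 0 1 0 hry.symm hyv hwq.symm (by grind) (by grind)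
      (by grind) hy hr (by grind) (by grind) (by grind) (by grind) (by decide)
  · have hv1 : nDeg H v = 1 := by
      have h1 := hd v
      have h2 := hpos hyv.symm
      have h3 := hLM y v hyv hy
      omega
    obtain ⟨w, w', hww, hw, hw', hwr, hwr'⟩ := hiso r
    have := hyv.ne
    exact hB.succ_of_insert_three 1 1 2 0 0 0 hyv hry.symm hww (by grind) (by grind)
      (by grind) hy hv1 (by grind) (by grind) (by grind) (by grind) (by decide)

end Extension

end Auxiliary

theorem stmt8 {V : Type*} [Fintype V] (G : SimpleGraph V) (t : ℕ)
    (hn : Fintype.card V = 4 * t) (hconn : G.Connected)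
    (hcubic : ∀ v, nDeg G v = 3) :
    ∃ H ≤ G, degCount H 0 = t + 1 ∧ degCount H 1 = t + 1 ∧
      degCount H 2 = t - 1 ∧ degCount H 3 = t - 1 := by
  have := hconn.nonempty
  have hpos : 0 < t := by
    have := Fintype.card_pos (α := V)
    omega
  have main : ∀ b < t, ∃ H, HasTreeProfile G H b := by
    intro b
    induction b with
    | zero => exact fun _ => exists_hasTreeProfile_zero fun v => by simp [hcubic v]
    | succ b ih =>
      intro hb
      obtain ⟨H, hH⟩ := ih (by omega)
      have := hH.zero
      exact hH.exists_succ hcubic hconn (by omega)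
  obtain ⟨H, hle, h0, h1, h2, h3⟩ := main (t - 1) (by omega)
  exact ⟨H, hle, by omega, by omega, h2, h3⟩
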